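/- Let k ≥ 1 and m′ ≥ 2, and write S_{k+1}(m′) = S_{k+1}(m′−1) • S_k(N). Then every global symbol of S_{k+1}(m′) (i.e., every symbol coming from the copy of S_k(N), equivalently every symbol of rank m′) is left-clamped in S_{k+1}(m′), and every global symbol except the very last symbol of S_{k+1}(m′) is right-clamped in S_{k+1}(m′). -/

import Mathlib

/-! ### Sequences with special blocks, encoded as token lists

A sequence with special blocks is encoded as a list of tokens: `Tok.sym a` is an
occurrence of the symbol `a`, and `Tok.op` / `Tok.cl` are the opening and closing
parentheses delimiting the special blocks. -/

/-- Tokens of a symbol sequence with special blocks. -/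
inductive Tok : Type where
  | sym : ℕ → Tok
  | op : Tok
  | cl : Tok
deriving DecidableEq, Repr

/-- Tokens of an endpoint sequence with special blocks: `L a` / `R a` are the
left/right endpoint letters of the symbol `a`, and `op`/`cl` delimit blocks. -/
inductive ETok : Type where
  | L : ℕ → ETok
  | R : ℕ → ETok
  | op : ETok
  | cl : ETok
deriving DecidableEq, Repr

/-- Fresh relabeling of the symbols of the `i`-th local copy. -/
def loc (i a : ℕ) : ℕ := 2 * Nat.pair i a

/-- Relabeling of the global symbols. -/
def glob (a : ℕ) : ℕ := 2 * a + 1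

/-- The underlying sequence of symbols of a token list (parentheses dropped). -/
def symsOf : List Tok → List ℕ
  | [] => []
  | Tok.sym a :: r => a :: symsOf r
  | _ :: r => symsOf r

/-- Read a special block: the symbols up to (and excluding) the next closing
parenthesis, together with the remainder of the list after that parenthesis. -/
def takeBlock : List Tok → List ℕ × List Tok
  | [] => ([], [])
  | Tok.cl :: r => ([], r)
  | Tok.sym a :: r => ((takeBlock r).1.cons a, (takeBlock r).2)
  | Tok.op :: r => takeBlock r

theorem takeBlock_len : ∀ l : List Tok, (takeBlock l).2.length ≤ l.length := by
  intro l
  induction l with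
  | nil => simp [takeBlock]
  | cons t r ih => cases t <;> simp [takeBlock] <;> omega

/-- Auxiliary function for the shuffle `A • B`: traverse the `i`-th fresh copy of
`A` (relabeling its symbols by `loc i`), inserting the next global symbol of the
list `ins` (relabeled by `glob`) at the end of each special block and duplicating
the previously last symbol of that block immediately after the block.  The third
argument remembers the (relabeled) last symbol seen. -/
def copyIns (i : ℕ) : List Tok → List ℕ → Option ℕ → List Tok
  | [], _, _ => []
  | Tok.sym a :: r, ins, _ => Tok.sym (loc i a) :: copyIns i r ins (some (loc i a))
  | Tok.op :: r, ins, p => Tok.op :: copyIns i r ins p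
  | Tok.cl :: r, b :: ins, some q =>
      Tok.sym (glob b) :: Tok.cl :: Tok.sym q :: copyIns i r ins (some q)
  | Tok.cl :: r, ins, p => Tok.cl :: copyIns i r ins p

/-- The modified copy `Aᵢ'` of `A` used in the shuffle `A • B`: the symbols of the
`i`-th special block `blk` of `B` are inserted into the special blocks of the copy,
and another copy of the last symbol of `blk` is appended at the very end. -/
def copyA (i : ℕ) (A : List Tok) (blk : List ℕ) : List Tok :=
  copyIns i A blk none ++ (blk.getLast?.elim [] fun a => [Tok.sym (glob a)])

/-- Auxiliary function for the shuffle: traverse `B` (relabeling its symbols by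
`glob`), replacing its `i`-th special block by the modified `i`-th copy of `A`. -/
def bulletAux (A : List Tok) : ℕ → List Tok → List Tok
  | _, [] => []
  | i, Tok.op :: r => copyA i A (takeBlock r).1 ++ bulletAux A (i + 1) (takeBlock r).2
  | i, Tok.sym a :: r => Tok.sym (glob a) :: bulletAux A i r
  | i, Tok.cl :: r => Tok.cl :: bulletAux A i r
termination_by _ l => l.length
decreasing_by
  · exact Nat.lt_succ_of_le (takeBlock_len r)
  · exact Nat.lt_succ_self _
  · exact Nat.lt_succ_self _

/-- The shuffle `A • B` of two sequences with special blocks. -/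
def bullet (A B : List Tok) : List Tok := bulletAux A 0 B

/-- Split each special block of length 2 into two special blocks of length 1. -/
def split2 : List Tok → List Tok
  | Tok.op :: Tok.sym a :: Tok.sym b :: Tok.cl :: r =>
      Tok.op :: Tok.sym a :: Tok.cl :: Tok.op :: Tok.sym b :: Tok.cl :: split2 r
  | t :: r => t :: split2 r
  | [] => []

/-- The Hart–Sharir sequence `S₁(m) = (1 2 ⋯ m) (m−1) ⋯ 2 1 2 ⋯ m`,
with a single special block `(1 2 ⋯ m)`. -/
def S1 (m : ℕ) : List Tok :=
  Tok.op :: ((List.range' 1 m).map Tok.sym) ++ Tok.cl ::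
    (((List.range' 1 (m - 1)).reverse.map Tok.sym) ++ ((List.range' 2 (m - 1)).map Tok.sym))

/-- The number of special blocks of a token sequence. -/
def numBlocks (S : List Tok) : ℕ := S.count Tok.op

/-- The Hart–Sharir sequences `S_k(m)`, defined by double recursion:
`S₁(m)` is the `N`-shaped sequence above; for `k ≥ 2`, `S_k(1)` is `S_{k−1}(2)` with
each special block of length 2 split into two special blocks of length 1; and for
`k, m ≥ 2`, `S_k(m) = S_k(m−1) • S_{k−1}(N)` where `N` is the number of special
blocks of `S_k(m−1)`.  (The value for `k = 0` or `m = 0` is junk.) -/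
def HS : ℕ → ℕ → List Tok
  | 0, _ => []
  | 1, m => S1 m
  | _ + 2, 0 => []
  | k + 2, 1 => split2 (HS (k + 1) 2)
  | k + 2, m + 2 => bullet (HS (k + 2) (m + 1)) (HS (k + 1) (numBlocks (HS (k + 2) (m + 1))))
termination_by k m => (k, m)



/-- The list of special blocks of a token sequence (each block as its list of symbols). -/
def blocksOf : List Tok → List (List ℕ)
  | [] => []
  | Tok.op :: r => (takeBlock r).1 :: blocksOf (takeBlock r).2
  | _ :: r => blocksOf r
termination_by l => l.length
decreasing_by
  · exact Nat.lt_succ_of_le (takeBlock_len r)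
  · exact Nat.lt_succ_self _

/-- The rank of a symbol: the position (counting from 1) that its first occurrence
occupies within its special block (`0` if the symbol lies in no special block). -/
def rankOf (S : List Tok) (a : ℕ) : ℕ :=
  match (blocksOf S).find? (fun b => decide (a ∈ b)) with
  | some b => b.idxOf a + 1
  | none => 0

/-- Two symbols have their first occurrences in the same special block. -/
def SameBlock (S : List Tok) (a b : ℕ) : Prop :=
  ∃ blk ∈ blocksOf S, a ∈ blk ∧ b ∈ blk

/-- The symbol `a` is left-clamped in the sequence `s`: `s` contains the
subsequence `b a b a`, where `b` is the symbol immediately preceding the first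
occurrence of `a` in `s`. -/
def LeftClamped (s : List ℕ) (a : ℕ) : Prop :=
  ∃ (u v : List ℕ) (b : ℕ), s = u ++ b :: a :: v ∧ a ∉ u ∧ b ≠ a ∧
    [b, a, b, a].Sublist s

/-- The symbol `a` is right-clamped in the sequence `s`: `s` contains the
subsequence `a b a b`, where `b` is the symbol immediately following the last
occurrence of `a` in `s`. -/
def RightClamped (s : List ℕ) (a : ℕ) : Prop :=
  ∃ (u v : List ℕ) (b : ℕ), s = u ++ a :: b :: v ∧ a ∉ v ∧ b ≠ a ∧
    [a, b, a, b].Sublist s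

/-- Auxiliary function for the endpoint sequence: the first argument collects the
symbols already seen.  The first occurrence of each symbol becomes an `L` letter,
its last occurrence becomes an `R` letter, all other occurrences are deleted, and
parentheses are kept. -/
def EAux : List ℕ → List Tok → List ETok
  | _, [] => []
  | seen, Tok.op :: r => ETok.op :: EAux seen r
  | seen, Tok.cl :: r => ETok.cl :: EAux seen r
  | seen, Tok.sym a :: r =>
      if a ∈ seen then
        if a ∈ symsOf r then EAux seen r else ETok.R a :: EAux seen r
      else ETok.L a :: EAux (a :: seen) r

/-- The endpoint sequence `E(S)` of a sequence with special blocks. -/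
def Efun (S : List Tok) : List ETok := EAux [] S

/-- Read a special block of an endpoint sequence: the labels of the `L` letters up
to the next closing parenthesis, and the remainder of the list after it. -/
def takeBlockE : List ETok → List ℕ × List ETok
  | [] => ([], [])
  | ETok.cl :: r => ([], r)
  | ETok.L a :: r => ((takeBlockE r).1.cons a, (takeBlockE r).2)
  | _ :: r => takeBlockE r

theorem takeBlockE_len : ∀ l : List ETok, (takeBlockE l).2.length ≤ l.length := by
  intro l
  induction l with
  | nil => simp [takeBlockE]
  | cons t r ih => cases t <;> simp [takeBlockE] <;> omega

/-- Auxiliary function for the endpoint shuffle `A ∘ B`: traverse the `i`-th fresh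
copy of `A` (relabeling by `loc i`), inserting the next left-endpoint letter of the
list `ins` (relabeled by `glob`) at the end of each special block. -/
def ecopyIns (i : ℕ) : List ETok → List ℕ → List ETok
  | [], _ => []
  | ETok.L a :: r, ins => ETok.L (loc i a) :: ecopyIns i r ins
  | ETok.R a :: r, ins => ETok.R (loc i a) :: ecopyIns i r ins
  | ETok.op :: r, ins => ETok.op :: ecopyIns i r ins
  | ETok.cl :: r, b :: ins => ETok.L (glob b) :: ETok.cl :: ecopyIns i r ins
  | ETok.cl :: r, [] => ETok.cl :: ecopyIns i r []

/-- Auxiliary function for the endpoint shuffle: traverse `B` (relabeling by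
`glob`), replacing its `i`-th special block by the `i`-th modified copy of `A`. -/
def eshufAux (A : List ETok) : ℕ → List ETok → List ETok
  | _, [] => []
  | i, ETok.op :: r => ecopyIns i A (takeBlockE r).1 ++ eshufAux A (i + 1) (takeBlockE r).2
  | i, ETok.L a :: r => ETok.L (glob a) :: eshufAux A i r
  | i, ETok.R a :: r => ETok.R (glob a) :: eshufAux A i r
  | i, ETok.cl :: r => ETok.cl :: eshufAux A i r
termination_by _ l => l.length
decreasing_by
  · exact Nat.lt_succ_of_le (takeBlockE_len r)
  · exact Nat.lt_succ_self _
  · exact Nat.lt_succ_self _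
  · exact Nat.lt_succ_self _

/-- The endpoint shuffle `A ∘ B` of two endpoint sequences with special blocks. -/
def eshuffle (A B : List ETok) : List ETok := eshufAux A 0 B

/-- The token list is a well-formed sequence with special blocks: a concatenation
of symbols and of parenthesized blocks consisting only of symbols. -/
inductive Blocked : List Tok → Prop
  | nil : Blocked []
  | sym (a : ℕ) {l : List Tok} : Blocked l → Blocked (Tok.sym a :: l)
  | blk (b : List ℕ) {l : List Tok} :
      Blocked l → Blocked (Tok.op :: b.map Tok.sym ++ Tok.cl :: l)

/-- The special blocks of `S` contain only first occurrences of symbols, and every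
symbol of `S` makes its first occurrence inside a special block. -/
def FirstOccBlocks (S : List Tok) : Prop :=
  (∀ (u b v : List Tok), S = u ++ Tok.op :: b ++ Tok.cl :: v →
      ∀ a : ℕ, Tok.sym a ∈ b → a ∉ symsOf u ∧ (symsOf b).count a = 1) ∧
  (∀ a ∈ symsOf S, ∃ (u b v : List Tok),
      S = u ++ Tok.op :: b ++ Tok.cl :: v ∧ Tok.sym a ∈ b ∧ a ∉ symsOf u)

/-! ### Structured sequences

A well-formed token list is encoded as a list of items, `Sum.inl a` being an occurrence of the
symbol `a` outside the special blocks and `Sum.inr b` a special block. -/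

/-- Sequences with special blocks, as lists of symbols and blocks. -/
abbrev BSeq := List (ℕ ⊕ List ℕ)

namespace BSeq

/-- The token list of a structured sequence. -/
def toks : BSeq → List Tok
  | [] => []
  | .inl a :: r => Tok.sym a :: toks r
  | .inr b :: r => Tok.op :: (b.map Tok.sym ++ Tok.cl :: toks r)

/-- The underlying symbol sequence. -/
def syms : BSeq → List ℕ
  | [] => []
  | .inl a :: r => a :: syms r
  | .inr b :: r => b ++ syms r

/-- The list of special blocks. -/
def blocks : BSeq → List (List ℕ)
  | [] => []
  | .inl _ :: r => blocks r
  | .inr b :: r => b :: blocks r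

/-- The modified `i`-th copy of `A`, with the symbols `ins` inserted in its blocks. -/
def copyIns (i : ℕ) : BSeq → List ℕ → BSeq
  | [], _ => []
  | .inl a :: r, ins => .inl (loc i a) :: copyIns i r ins
  | .inr b :: r, g :: ins =>
      .inr (b.map (loc i) ++ [glob g]) :: .inl (loc i (b.getLastD 0)) :: copyIns i r ins
  | .inr b :: r, [] => .inr (b.map (loc i)) :: copyIns i r []

/-- The shuffle, with copies of `A` numbered from `i`. -/
def shuffle (A : BSeq) : ℕ → BSeq → BSeq
  | _, [] => []
  | i, .inl a :: r => .inl (glob a) :: shuffle A i r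
  | i, .inr b :: r => copyIns i A b ++ .inl (glob (b.getLastD 0)) :: shuffle A (i + 1) r

/-- Split every block into blocks of length 1. -/
def split : BSeq → BSeq
  | [] => []
  | .inl a :: r => .inl a :: split r
  | .inr b :: r => b.map (fun x => .inr [x]) ++ split r

/-- Every block `b`, followed by the rest `r` of the sequence, satisfies `P b r`. -/
def ForallBlock (P : List ℕ → BSeq → Prop) : BSeq → Prop
  | [] => True
  | .inl _ :: r => ForallBlock P r
  | .inr b :: r => P b r ∧ ForallBlock P r

/-- When the symbols of `T` have been seen already, all blocks have length `m` and consist of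
first occurrences, and all first occurrences are inside blocks. -/
def WellFormed (m : ℕ) : Set ℕ → BSeq → Prop
  | _, [] => True
  | T, .inl a :: r => a ∈ T ∧ WellFormed m T r
  | T, .inr b :: r =>
      b.length = m ∧ b.Nodup ∧ (∀ x ∈ b, x ∉ T) ∧ WellFormed m (T ∪ {x | x ∈ b}) r

/-- The last occurrence of `a` and the symbol `b` following it lie outside the blocks, and
`a b a b` is a subsequence. -/
def RightClampedOutside (S : BSeq) (a : ℕ) : Prop :=
  ∃ (u v : BSeq) (b : ℕ), S = u ++ .inl a :: .inl b :: v ∧ a ∉ syms v ∧ b ≠ a ∧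
    [a, b, a, b].Sublist (syms S)

/-- All symbols of `b` but the last one recur in `r`. -/
def Recurs (b : List ℕ) (r : BSeq) : Prop := ∀ x ∈ b.dropLast, x ∈ syms r

/-- The block `b` ends with `q a`, and is followed by `q` and, later on, `a`. -/
def ClampsLast (b : List ℕ) (r : BSeq) : Prop :=
  ∃ (c : List ℕ) (q a : ℕ) (r' : BSeq), b = c ++ [q, a] ∧ r = .inl q :: r' ∧ a ∈ syms r'

/-- The invariants of Hart–Sharir sequences. -/
structure Good (m : ℕ) (S : BSeq) : Prop where
  blocks_ne : blocks S ≠ []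
  wellFormed : WellFormed m ∅ S
  recurs : ForallBlock Recurs S
  clamped : ∀ a ∈ syms S, (syms S).getLast? = some a ∨ RightClampedOutside S a

theorem syms_append (s t : BSeq) : syms (s ++ t) = syms s ++ syms t := by
  induction s with
  | nil => rfl
  | cons x s ih => cases x <;> simp [syms, ih]

theorem blocks_append (s t : BSeq) : blocks (s ++ t) = blocks s ++ blocks t := by
  induction s with
  | nil => rfl
  | cons x s ih => cases x <;> simp [blocks, ih]

theorem symsOf_map_append (b : List ℕ) (l : List Tok) :
    symsOf (b.map Tok.sym ++ l) = b ++ symsOf l := by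
  induction b with
  | nil => rfl
  | cons x b ih => simp [symsOf, ih]

theorem symsOf_toks (S : BSeq) : symsOf (toks S) = syms S := by
  induction S with
  | nil => rfl
  | cons x S ih => cases x <;> simp [toks, symsOf, syms, symsOf_map_append, ih]

theorem takeBlock_map_append (b : List ℕ) (l : List Tok) :
    takeBlock (b.map Tok.sym ++ Tok.cl :: l) = (b, l) := by
  induction b with
  | nil => rfl
  | cons x b ih => simp [takeBlock, ih]

theorem blocksOf_toks (S : BSeq) : blocksOf (toks S) = blocks S := by
  induction S with
  | nil => simp [toks, blocks, blocksOf]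
  | cons x S ih => cases x <;> simp [toks, blocksOf, blocks, takeBlock_map_append, ih]

theorem numBlocks_toks (S : BSeq) : numBlocks (toks S) = (blocks S).length := by
  have hb (b : List ℕ) : (b.map Tok.sym).count Tok.op = 0 := by
    simp [List.count_eq_zero]
  unfold numBlocks
  induction S with
  | nil => rfl
  | cons x S ih => cases x <;> simp [toks, blocks, hb, ih]

theorem ForallBlock.append {P : List ℕ → BSeq → Prop} {s t : BSeq}
    (hs : ForallBlock (fun b r => P b (r ++ t)) s) (ht : ForallBlock P t) :
    ForallBlock P (s ++ t) := by
  induction s with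
  | nil => exact ht
  | cons x s ih =>
    cases x with
    | inl a => exact ih hs
    | inr b => exact ⟨hs.1, ih hs.2⟩

theorem ForallBlock.imp {P Q : List ℕ → BSeq → Prop} {s : BSeq}
    (hs : ForallBlock P s) (h : ∀ b r, P b r → Q b r) : ForallBlock Q s := by
  induction s with
  | nil => trivial
  | cons x s ih =>
    cases x with
    | inl a => exact ih hs
    | inr b => exact ⟨h _ _ hs.1, ih hs.2⟩

theorem WellFormed.append {m : ℕ} {s t : BSeq} {T : Set ℕ} (hs : WellFormed m T s)
    (ht : WellFormed m (T ∪ {x | x ∈ syms s}) t) : WellFormed m T (s ++ t) := by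
  induction s generalizing T with
  | nil => simpa [syms] using ht
  | cons x s ih =>
    cases x with
    | inl a =>
      refine ⟨hs.1, ih hs.2 ?_⟩
      convert ht using 1
      ext y
      have := hs.1
      simp only [syms, Set.mem_union, Set.mem_ofPred_eq, List.mem_cons]
      constructor
      · tauto
      · rintro (h | rfl | h) <;> tauto
    | inr b =>
      refine ⟨hs.1, hs.2.1, hs.2.2.1, ih hs.2.2.2 ?_⟩
      convert ht using 1
      ext y
      simp [syms, or_assoc]

theorem WellFormed.length_of_mem_blocks {m : ℕ} {s : BSeq} {T : Set ℕ} (hs : WellFormed m T s) :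
    ∀ b ∈ blocks s, b.length = m := by
  induction s generalizing T with
  | nil => simp [blocks]
  | cons x s ih =>
    cases x with
    | inl a => exact ih hs.2
    | inr b =>
      intro c hc
      rcases List.mem_cons.1 hc with rfl | hc
      · exact hs.1
      · exact ih hs.2.2.2 c hc

theorem loc_inj {i j a b : ℕ} : loc i a = loc j b ↔ i = j ∧ a = b := by
  simp [loc, Nat.pair_eq_pair]

theorem glob_inj {a b : ℕ} : glob a = glob b ↔ a = b := by
  simp [glob]

theorem loc_ne_glob (i a b : ℕ) : loc i a ≠ glob b := by
  unfold loc glob; omega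

/-! ### Compatibility with the token-list operations -/

theorem copyIns_map_append (i : ℕ) (b : List ℕ) (hb : b ≠ []) (l : List Tok) (ins : List ℕ)
    (p : Option ℕ) :
    _root_.copyIns i (b.map Tok.sym ++ l) ins p =
      (b.map (loc i)).map Tok.sym ++ _root_.copyIns i l ins (some (loc i (b.getLastD 0))) := by
  induction b generalizing p with
  | nil => exact absurd rfl hb
  | cons x b ih =>
    cases b with
    | nil => simp [_root_.copyIns]
    | cons y b =>
      have := ih (by simp) (some (loc i x))
      simp only [List.map_cons, List.cons_append, _root_.copyIns] at this ⊢
      simpa using this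

theorem copyIns_toks (i : ℕ) (A : BSeq) (hA : ∀ b ∈ blocks A, b ≠ []) (ins : List ℕ)
    (p : Option ℕ) : _root_.copyIns i (toks A) ins p = toks (copyIns i A ins) := by
  induction A generalizing ins p with
  | nil => simp [toks, _root_.copyIns, copyIns]
  | cons x A ih =>
    cases x with
    | inl a =>
      simp only [toks, _root_.copyIns, copyIns]
      rw [ih hA]
    | inr b =>
      have hA' : ∀ b ∈ blocks A, b ≠ [] := fun c hc => hA c (List.mem_cons_of_mem _ hc)
      have hb : b ≠ [] := hA b (by simp [blocks])
      cases ins with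
      | nil =>
        simp only [toks, _root_.copyIns, copyIns]
        rw [copyIns_map_append i b hb]
        simp [_root_.copyIns, ih hA']
      | cons g ins =>
        simp only [toks, _root_.copyIns, copyIns]
        rw [copyIns_map_append i b hb]
        simp [_root_.copyIns, ih hA']

theorem toks_append (s t : BSeq) : toks (s ++ t) = toks s ++ toks t := by
  induction s with
  | nil => rfl
  | cons x s ih => cases x <;> simp [toks, ih]

theorem bulletAux_toks (A : BSeq) (hA : ∀ b ∈ blocks A, b ≠ []) (i : ℕ) (B : BSeq)
    (hB : ∀ b ∈ blocks B, b ≠ []) :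
    bulletAux (toks A) i (toks B) = toks (shuffle A i B) := by
  induction B generalizing i with
  | nil => simp [toks, bulletAux, shuffle]
  | cons x B ih =>
    cases x with
    | inl a => simp [toks, bulletAux, shuffle, ih i hB]
    | inr b =>
      have hB' : ∀ b ∈ blocks B, b ≠ [] := fun c hc => hB c (List.mem_cons_of_mem _ hc)
      have hb : b ≠ [] := hB b (by simp [blocks])
      have hl : b.getLast? = some (b.getLastD 0) := by
        rw [List.getLastD_eq_getLast?, List.getLast?_eq_some_getLast hb]; rfl
      simp only [toks, bulletAux, shuffle, takeBlock_map_append, ih (i + 1) hB', toks_append,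
        copyA, copyIns_toks i A hA, hl]
      simp

theorem split2_toks (S : BSeq) (hS : ∀ b ∈ blocks S, b.length = 2) :
    split2 (toks S) = toks (split S) := by
  induction S with
  | nil => simp [toks, split2, split]
  | cons x S ih =>
    cases x with
    | inl a => simp [toks, split2, split, ih hS]
    | inr b =>
      have hS' : ∀ b ∈ blocks S, b.length = 2 := fun c hc => hS c (List.mem_cons_of_mem _ hc)
      obtain ⟨p, q, rfl⟩ := List.length_eq_two.1 (hS b (by simp [blocks]))
      simp [toks, split2, split, ih hS']

/-! ### Modified copies -/

theorem copyIns_append (i : ℕ) (s t : BSeq) (ins : List ℕ) :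
    copyIns i (s ++ t) ins = copyIns i s ins ++ copyIns i t (ins.drop (blocks s).length) := by
  induction s generalizing ins with
  | nil => simp [copyIns, blocks]
  | cons x s ih =>
    cases x with
    | inl a => simp [copyIns, blocks, ih]
    | inr b => cases ins <;> simp [copyIns, blocks, ih]

theorem getLastD_mem {b : List ℕ} (hb : b ≠ []) : b.getLastD 0 ∈ b := by
  rw [List.getLastD_eq_getLast?, List.getLast?_eq_some_getLast hb]
  exact List.getLast_mem hb

theorem mem_syms_copyIns {i : ℕ} {A : BSeq} (hA : ∀ b ∈ blocks A, b ≠ []) {ins : List ℕ} {y : ℕ}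
    (hy : y ∈ syms (copyIns i A ins)) :
    (∃ x ∈ syms A, y = loc i x) ∨ ∃ g ∈ ins, y = glob g := by
  induction A generalizing ins with
  | nil => simp [copyIns, syms] at hy
  | cons x A ih =>
    cases x with
    | inl a =>
      rcases List.mem_cons.1 hy with rfl | hy
      · exact .inl ⟨a, by simp [syms], rfl⟩
      · rcases ih hA hy with ⟨x, hx, rfl⟩ | h
        · exact .inl ⟨x, by simp [syms, hx], rfl⟩
        · exact .inr h
    | inr b =>
      have ih := @ih (fun c hc => hA c (List.mem_cons_of_mem _ hc))
      have hb := getLastD_mem (hA b (by simp [blocks]))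
      cases ins with
      | nil =>
        simp only [copyIns, syms, List.mem_append, List.mem_map] at hy ⊢
        rcases hy with ⟨x, hx, rfl⟩ | hy
        · exact .inl ⟨x, .inl hx, rfl⟩
        · rcases ih hy with ⟨x, hx, rfl⟩ | h
          · exact .inl ⟨x, .inr hx, rfl⟩
          · exact .inr h
      | cons g ins =>
        simp only [copyIns, syms, List.mem_append, List.mem_map, List.mem_cons,
          List.not_mem_nil, or_false] at hy ⊢
        rcases hy with (⟨x, hx, rfl⟩ | rfl) | rfl | hy
        · exact .inl ⟨x, .inl hx, rfl⟩
        · exact .inr ⟨g, .inl rfl, rfl⟩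
        · exact .inl ⟨_, .inl hb, rfl⟩
        · rcases ih hy with ⟨x, hx, rfl⟩ | ⟨g', hg, rfl⟩
          · exact .inl ⟨x, .inr hx, rfl⟩
          · exact .inr ⟨g', .inr hg, rfl⟩

theorem map_loc_sublist_copyIns (i : ℕ) (A : BSeq) (ins : List ℕ) :
    ((syms A).map (loc i)).Sublist (syms (copyIns i A ins)) := by
  induction A generalizing ins with
  | nil => simp [syms]
  | cons x A ih =>
    cases x with
    | inl a => simpa [syms, copyIns] using ih ins
    | inr b =>
      cases ins with
      | nil => simpa [syms, copyIns] using ih []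
      | cons g ins =>
        simp only [syms, copyIns, List.map_append, List.append_assoc]
        exact (((ih ins).cons _).cons _).append_left _

theorem map_glob_sublist_copyIns (i : ℕ) (A : BSeq) (ins : List ℕ)
    (h : ins.length ≤ (blocks A).length) :
    (ins.map glob).Sublist (syms (copyIns i A ins)) := by
  induction A generalizing ins with
  | nil =>
    have : ins = [] := by simpa [blocks] using h
    simp [this]
  | cons x A ih =>
    cases x with
    | inl a => exact (ih ins h).cons _
    | inr b =>
      cases ins with
      | nil => simp
      | cons g ins =>
        have := ih ins (by simpa [blocks] using h)
        simp only [syms, copyIns, List.map_cons, List.append_assoc]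
        exact ((this.cons _).cons_cons (glob g)).trans (List.sublist_append_right _ _)

theorem mem_syms_copyIns_loc {i : ℕ} {A : BSeq} {ins : List ℕ} {x : ℕ} (hx : x ∈ syms A) :
    loc i x ∈ syms (copyIns i A ins) :=
  (map_loc_sublist_copyIns i A ins).subset (List.mem_map_of_mem hx)

theorem WellFormed.copyIns {m : ℕ} (hm : m ≠ 0) (i : ℕ) {A : BSeq} {T U : Set ℕ} {ins : List ℕ}
    (hA : WellFormed m T A) (hTU : ∀ x, loc i x ∈ U ↔ x ∈ T) (hins : ∀ g ∈ ins, glob g ∉ U)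
    (hnd : ins.Nodup) (hlen : (blocks A).length = ins.length) :
    WellFormed (m + 1) U (BSeq.copyIns i A ins) := by
  induction A generalizing T U ins with
  | nil => simp [BSeq.copyIns, WellFormed]
  | cons x A ih =>
    cases x with
    | inl a => exact ⟨(hTU a).2 hA.1, ih hA.2 hTU hins hnd hlen⟩
    | inr b =>
      obtain ⟨hbl, hbn, hbT, hA⟩ := hA
      have hb : b ≠ [] := by rintro rfl; exact hm hbl.symm
      cases ins with
      | nil => simp [blocks] at hlen
      | cons g ins =>
        rw [List.nodup_cons] at hnd
        refine ⟨by simp [hbl], ?_, ?_, ?_, ih hA ?_ ?_ hnd.2 (by simpa [blocks] using hlen)⟩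
        · rw [List.nodup_append]
          refine ⟨hbn.map fun x y h => (loc_inj.1 h).2, by simp, ?_⟩
          simp only [List.mem_map, List.mem_singleton]
          rintro _ ⟨x, -, rfl⟩ _ rfl
          exact loc_ne_glob _ _ _
        · simp only [List.mem_append, List.mem_map, List.mem_singleton]
          rintro _ (⟨x, hx, rfl⟩ | rfl)
          · rw [hTU]; exact hbT x hx
          · exact hins g (by simp)
        · exact .inr (List.mem_append_left _ (List.mem_map_of_mem (getLastD_mem hb)))
        · intro x
          simp [hTU, loc_inj, loc_ne_glob]
        · intro g' hg'
          have h1 := hins g' (by simp [hg'])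
          have h2 : g' ≠ g := by rintro rfl; exact hnd.1 hg'
          simp [h1, h2, glob_inj, fun x => loc_ne_glob i x g']

theorem forallBlock_copyIns {m : ℕ} (hm : m ≠ 0) (i : ℕ) {A : BSeq} {ins : List ℕ}
    (hA : ∀ b ∈ blocks A, b.length = m) (hlen : (blocks A).length = ins.length) :
    ForallBlock (fun b r => ∃ c q g r', b = c ++ [q, glob g] ∧ g ∈ ins ∧ r = .inl q :: r')
      (copyIns i A ins) := by
  induction A generalizing ins with
  | nil => simp [copyIns, ForallBlock]
  | cons x A ih =>
    cases x with
    | inl a => exact ih hA hlen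
    | inr b =>
      have hb : b ≠ [] := by rintro rfl; exact hm (hA [] (by simp [blocks])).symm
      cases ins with
      | nil => simp [blocks] at hlen
      | cons g ins =>
        refine ⟨⟨b.dropLast.map (loc i), loc i (b.getLastD 0), g, _, ?_, by simp, rfl⟩, ?_⟩
        · conv_lhs => rw [← List.dropLast_concat_getLast hb]
          simp [List.getLastD_eq_getLast?, List.getLast?_eq_some_getLast hb]
        · refine (ih (fun c hc => hA c (List.mem_cons_of_mem _ hc))
            (by simpa [blocks] using hlen)).imp ?_
          rintro _ _ ⟨c, q, g', r', h1, h2, h3⟩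
          exact ⟨c, q, g', r', h1, List.mem_cons_of_mem _ h2, h3⟩

theorem recurs_copyIns {m : ℕ} (hm : m ≠ 0) (i : ℕ) {A : BSeq} {ins : List ℕ}
    (hA : ∀ b ∈ blocks A, b.length = m) (hlen : (blocks A).length = ins.length)
    (hrec : ForallBlock Recurs A) : ForallBlock Recurs (copyIns i A ins) := by
  induction A generalizing ins with
  | nil => simp [copyIns, ForallBlock]
  | cons x A ih =>
    cases x with
    | inl a => exact ih hA hlen hrec
    | inr b =>
      have hb : b ≠ [] := by rintro rfl; exact hm (hA [] (by simp [blocks])).symm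
      cases ins with
      | nil => simp [blocks] at hlen
      | cons g ins =>
        refine ⟨?_, ih (fun c hc => hA c (List.mem_cons_of_mem _ hc))
            (by simpa [blocks] using hlen) hrec.2⟩
        intro y hy
        rw [List.dropLast_concat, List.mem_map] at hy
        obtain ⟨x, hx, rfl⟩ := hy
        rw [← List.dropLast_concat_getLast hb, List.mem_append, List.mem_singleton] at hx
        rcases hx with hx | rfl
        · exact List.mem_cons_of_mem _ (mem_syms_copyIns_loc (hrec.1 x hx))
        · simp [syms, List.getLastD_eq_getLast?, List.getLast?_eq_some_getLast hb]

theorem exists_last_block {A : BSeq} (hA : blocks A ≠ []) :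
    ∃ (u : BSeq) (b t : List ℕ), A = u ++ .inr b :: t.map .inl := by
  induction A with
  | nil => exact absurd rfl hA
  | cons x A ih =>
    by_cases h : blocks A = []
    · cases x with
      | inl a => exact absurd h hA
      | inr b =>
        have : ∀ S : BSeq, blocks S = [] → ∃ t : List ℕ, S = t.map .inl := by
          intro S hS
          induction S with
          | nil => exact ⟨[], rfl⟩
          | cons x S ih =>
            cases x with
            | inl a => obtain ⟨t, rfl⟩ := ih hS; exact ⟨a :: t, rfl⟩
            | inr b => simp [blocks] at hS
        obtain ⟨t, rfl⟩ := this A h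
        exact ⟨[], b, t, rfl⟩
    · obtain ⟨u, b, t, rfl⟩ := ih h
      exact ⟨x :: u, b, t, rfl⟩

theorem syms_map_inl (t : List ℕ) : syms (t.map .inl) = t := by
  induction t with
  | nil => rfl
  | cons a t ih => simp [syms, ih]

theorem blocks_map_inl (t : List ℕ) : blocks (t.map .inl) = [] := by
  induction t with
  | nil => rfl
  | cons a t ih => simp [blocks, ih]

theorem copyIns_map_inl (i : ℕ) (t ins : List ℕ) :
    copyIns i (t.map .inl) ins = (t.map (loc i)).map .inl := by
  induction t with
  | nil => rfl
  | cons a t ih => simp [copyIns, ih]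

theorem WellFormed.mem_of_append_map_inl {m : ℕ} {T : Set ℕ} {s : BSeq} {t : List ℕ}
    (h : WellFormed m T (s ++ t.map .inl)) {x : ℕ} (hx : x ∈ t) : x ∈ T ∨ x ∈ syms s := by
  induction s generalizing T with
  | nil =>
    left
    induction t with
    | nil => simp at hx
    | cons a t ih =>
      rcases List.mem_cons.1 hx with rfl | hx
      · exact h.1
      · exact ih hx h.2
  | cons y s ih =>
    cases y with
    | inl a =>
      rcases ih h.2 with h | h
      · exact .inl h
      · exact .inr (List.mem_cons_of_mem _ h)
    | inr b =>
      rcases ih h.2.2.2 with (h | h) | h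
      · exact .inl h
      · exact .inr (List.mem_append_left _ h)
      · exact .inr (List.mem_append_right _ h)

theorem copyIns_last {m : ℕ} (hm : m ≠ 0) (i : ℕ) {A : BSeq} (hA : Good m A) {ins : List ℕ}
    (hlen : (blocks A).length = ins.length) {x : ℕ} (hx : (syms A).getLast? = some x) :
    (∃ u, copyIns i A ins = u ++ [.inl (loc i x)]) ∧
      [loc i x, glob (ins.getLastD 0), loc i x].Sublist (syms (copyIns i A ins)) := by
  obtain ⟨u, b, t, rfl⟩ := exists_last_block hA.blocks_ne
  have hb : b ≠ [] := by
    rintro rfl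
    exact hm (hA.wellFormed.length_of_mem_blocks [] (by simp [blocks_append, blocks])).symm
  obtain ⟨ins, g, rfl⟩ : ∃ l g, ins = l ++ [g] := by
    have : ins ≠ [] := by rintro rfl; simp [blocks_append, blocks] at hlen
    exact ⟨_, _, (List.dropLast_concat_getLast this).symm⟩
  have hlen' : (blocks u).length = ins.length := by
    simpa [blocks_append, blocks, blocks_map_inl] using hlen
  have hxm : x ∈ syms u ++ b := by
    have h1 := List.mem_of_getLast? hx
    simp only [syms_append, syms, syms_map_inl, ← List.append_assoc] at h1
    rcases List.mem_append.1 h1 with h1 | h1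
    · exact h1
    · have := WellFormed.mem_of_append_map_inl (s := u ++ [.inr b]) (t := t) (m := m) (T := ∅)
        (by simpa using hA.wellFormed) h1
      simpa [syms_append, syms] using this
  have hcopy : copyIns i (u ++ .inr b :: t.map .inl) (ins ++ [g]) =
      copyIns i u (ins ++ [g]) ++ .inr (b.map (loc i) ++ [glob g]) ::
        ((b.getLastD 0 :: t).map (loc i)).map .inl := by
    rw [copyIns_append, hlen', List.drop_left, copyIns, copyIns_map_inl]
    simp
  have hlast : (b.getLastD 0 :: t).getLast? = some x := by
    rw [← hx]
    simp only [syms_append, syms, syms_map_inl]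
    cases t with
    | nil => simp [List.getLast?_append, List.getLastD_eq_getLast?, List.getLast?_eq_some_getLast hb]
    | cons y t => simp [List.getLast?_append, List.getLast?_cons]
  obtain ⟨w, hw⟩ : ∃ w, b.getLastD 0 :: t = w ++ [x] := by
    rw [List.getLast?_eq_some_iff] at hlast
    exact hlast
  rw [hcopy, hw]
  constructor
  · exact ⟨copyIns i u (ins ++ [g]) ++ .inr (b.map (loc i) ++ [glob g]) ::
        (w.map (loc i)).map .inl, by simp⟩
  · have h1 : [loc i x].Sublist (syms (copyIns i u (ins ++ [g])) ++ b.map (loc i)) := by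
      rw [List.singleton_sublist, List.mem_append]
      rcases List.mem_append.1 hxm with h | h
      · exact .inl (mem_syms_copyIns_loc h)
      · exact .inr (List.mem_map_of_mem h)
    have h2 : [loc i x].Sublist ((w ++ [x]).map (loc i)) := by
      simp
    have := (h1.append (List.Sublist.refl [glob g])).append h2
    simpa only [syms_append, syms, syms_map_inl, List.append_assoc, List.getLastD_concat,
      List.cons_append, List.nil_append] using this

/-! ### Shuffles -/

theorem shuffle_append (A : BSeq) (i : ℕ) (s t : BSeq) :
    shuffle A i (s ++ t) = shuffle A i s ++ shuffle A (i + (blocks s).length) t := by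
  induction s generalizing i with
  | nil => simp [shuffle, blocks]
  | cons x s ih =>
    cases x with
    | inl a => simp [shuffle, blocks, ih]
    | inr b => simp [shuffle, blocks, ih, Nat.add_assoc, Nat.add_comm 1]

theorem mem_syms_shuffle {A : BSeq} (hA : ∀ b ∈ blocks A, b ≠ []) {i : ℕ} {B : BSeq}
    (hB : ∀ b ∈ blocks B, b ≠ []) {y : ℕ} (hy : y ∈ syms (shuffle A i B)) :
    (∃ j ≥ i, ∃ x ∈ syms A, y = loc j x) ∨ ∃ g ∈ syms B, y = glob g := by
  induction B generalizing i with
  | nil => simp [shuffle, syms] at hy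
  | cons x B ih =>
    cases x with
    | inl a =>
      rcases List.mem_cons.1 hy with rfl | hy
      · exact .inr ⟨a, by simp [syms], rfl⟩
      · rcases ih hB hy with h | ⟨g, hg, rfl⟩
        · exact .inl h
        · exact .inr ⟨g, by simp [syms, hg], rfl⟩
    | inr b =>
      have hb := getLastD_mem (hB b (by simp [blocks]))
      simp only [shuffle, syms_append, syms, List.mem_append, List.mem_cons] at hy ⊢
      rcases hy with hy | rfl | hy
      · rcases mem_syms_copyIns hA hy with ⟨x, hx, rfl⟩ | ⟨g, hg, rfl⟩
        · exact .inl ⟨i, le_rfl, x, hx, rfl⟩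
        · exact .inr ⟨g, .inl hg, rfl⟩
      · exact .inr ⟨_, .inl hb, rfl⟩
      · rcases ih (fun c hc => hB c (List.mem_cons_of_mem _ hc)) hy with
          ⟨j, hj, h⟩ | ⟨g, hg, rfl⟩
        · exact .inl ⟨j, by omega, h⟩
        · exact .inr ⟨g, .inr hg, rfl⟩

theorem map_glob_sublist_shuffle (A : BSeq) (i : ℕ) (B : BSeq)
    (hB : ∀ b ∈ blocks B, b.length = (blocks A).length) :
    ((syms B).map glob).Sublist (syms (shuffle A i B)) := by
  induction B generalizing i with
  | nil => simp [syms]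
  | cons x B ih =>
    cases x with
    | inl a => exact (ih i hB).cons_cons _
    | inr b =>
      have h1 := map_glob_sublist_copyIns i A b (hB b (by simp [blocks])).le
      have h2 := ih (i + 1) (fun c hc => hB c (List.mem_cons_of_mem _ hc))
      simp only [syms, shuffle, syms_append, List.map_append]
      exact h1.append (h2.cons _)

theorem getLast?_syms_shuffle (A : BSeq) (i : ℕ) (B : BSeq) (hB : ∀ b ∈ blocks B, b ≠ []) :
    (syms (shuffle A i B)).getLast? = (syms B).getLast?.map glob := by
  induction B generalizing i with
  | nil => simp [syms, shuffle]
  | cons x B ih =>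
    cases x with
    | inl a =>
      have := ih i hB
      simp only [syms, shuffle, List.getLast?_cons, this]
      cases (syms B).getLast? <;> simp
    | inr b =>
      have := ih (i + 1) (fun c hc => hB c (List.mem_cons_of_mem _ hc))
      have hb := hB b (by simp [blocks])
      simp only [syms, shuffle, syms_append, List.getLast?_append, List.getLast?_cons, this]
      cases (syms B).getLast? <;>
        simp [List.getLastD_eq_getLast?, List.getLast?_eq_some_getLast hb]

theorem WellFormed.shuffle {m : ℕ} (hm : m ≠ 0) {A : BSeq} (hA : WellFormed m ∅ A)
    (hA0 : blocks A ≠ []) {i : ℕ} {B : BSeq} {T U : Set ℕ}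
    (hB : WellFormed (blocks A).length T B) (hTU : ∀ x, glob x ∈ U ↔ x ∈ T)
    (hU : ∀ j ≥ i, ∀ x, loc j x ∉ U) : WellFormed (m + 1) U (BSeq.shuffle A i B) := by
  induction B generalizing T U i with
  | nil => simp [BSeq.shuffle, WellFormed]
  | cons x B ih =>
    cases x with
    | inl a => exact ⟨(hTU a).2 hB.1, ih hB.2 hTU hU⟩
    | inr b =>
      obtain ⟨hbl, hbn, hbT, hB⟩ := hB
      have hb : b ≠ [] := by rintro rfl; exact hA0 (List.length_eq_zero_iff.1 hbl.symm)
      have hA1 : ∀ b ∈ blocks A, b ≠ [] := by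
        rintro _ h rfl; exact hm (hA.length_of_mem_blocks _ h).symm
      have hsub : ∀ g ∈ b, glob g ∈ syms (BSeq.copyIns i A b) := fun g hg =>
        (map_glob_sublist_copyIns i A b hbl.le).subset (List.mem_map_of_mem hg)
      refine WellFormed.append (hA.copyIns hm i ?_ ?_ hbn hbl.symm) ⟨?_, ih hB ?_ ?_⟩
      · intro x; simpa using hU i le_rfl x
      · intro g hg; rw [hTU]; exact hbT g hg
      · exact .inr (hsub _ (getLastD_mem hb))
      · intro x
        simp only [Set.mem_union, Set.mem_ofPred_eq, hTU]
        refine or_congr_right ⟨fun h => ?_, hsub x⟩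
        rcases mem_syms_copyIns hA1 h with ⟨y, -, h⟩ | ⟨g, hg, h⟩
        · exact absurd h.symm (loc_ne_glob _ _ _)
        · rwa [glob_inj.1 h]
      · rintro j hj x (h | h)
        · exact hU j (by omega) x h
        · rcases mem_syms_copyIns hA1 h with ⟨y, -, h⟩ | ⟨g, hg, h⟩
          · have := (loc_inj.1 h).1; omega
          · exact loc_ne_glob _ _ _ h

theorem blocks_shuffle_ne {A : BSeq} (hA : blocks A ≠ []) (i : ℕ) {B : BSeq}
    (hB : blocks B ≠ []) : blocks (shuffle A i B) ≠ [] := by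
  have hcopy (j : ℕ) (ins : List ℕ) : (blocks (copyIns j A ins)).length = (blocks A).length := by
    clear hA
    induction A generalizing ins with
    | nil => rfl
    | cons x A ih => cases x <;> cases ins <;> simp [copyIns, blocks, ih]
  induction B generalizing i with
  | nil => exact absurd rfl hB
  | cons x B ih =>
    cases x with
    | inl a => exact ih i hB
    | inr b =>
      have : blocks (copyIns i A b) ≠ [] := by
        rw [← List.length_pos_iff, hcopy, List.length_pos_iff]; exact hA
      simp [shuffle, blocks_append, this]

theorem Recurs.append {b : List ℕ} {r : BSeq} (h : Recurs b r) (t : BSeq) :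
    Recurs b (r ++ t) := fun x hx => by
  rw [syms_append]; exact List.mem_append_left _ (h x hx)

theorem recurs_shuffle {m : ℕ} (hm : m ≠ 0) {A : BSeq} (hA : Good m A) (i : ℕ) {B : BSeq}
    (hB : ∀ b ∈ blocks B, b.length = (blocks A).length) :
    ForallBlock Recurs (shuffle A i B) := by
  induction B generalizing i with
  | nil => trivial
  | cons x B ih =>
    cases x with
    | inl a => exact ih i hB
    | inr b =>
      refine ForallBlock.append ?_ (ih (i + 1) (fun c hc => hB c (List.mem_cons_of_mem _ hc)))
      exact (recurs_copyIns hm i hA.wellFormed.length_of_mem_blocks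
        (hB b (by simp [blocks])).symm hA.recurs).imp fun b r h => h.append _

theorem clampsLast_shuffle {m : ℕ} (hm : m ≠ 0) {A : BSeq} (hA : Good m A) (i : ℕ) {B : BSeq}
    (hB : ∀ b ∈ blocks B, b.length = (blocks A).length) (hrec : ForallBlock Recurs B) :
    ForallBlock ClampsLast (shuffle A i B) := by
  induction B generalizing i with
  | nil => trivial
  | cons x B ih =>
    cases x with
    | inl a => exact ih i hB hrec
    | inr b =>
      have hB' : ∀ c ∈ blocks B, c.length = (blocks A).length :=
        fun c hc => hB c (List.mem_cons_of_mem _ hc)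
      refine ForallBlock.append ?_ (ih (i + 1) hB' hrec.2)
      refine (forallBlock_copyIns hm i hA.wellFormed.length_of_mem_blocks
        (hB b (by simp [blocks])).symm).imp ?_
      rintro _ _ ⟨c, q, g, r', rfl, hg, rfl⟩
      refine ⟨c, q, glob g, _, rfl, rfl, ?_⟩
      have hb : b ≠ [] := List.ne_nil_of_mem hg
      rw [← List.dropLast_concat_getLast hb, List.mem_append, List.mem_singleton] at hg
      change glob g ∈ syms (r' ++ .inl (glob (b.getLastD 0)) :: shuffle A (i + 1) B)
      rw [syms_append, syms, List.mem_append, List.mem_cons]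
      rcases hg with hg | rfl
      · exact .inr (.inr ((map_glob_sublist_shuffle A (i + 1) B hB').subset
          (List.mem_map_of_mem (hrec.1 g hg))))
      · right; left
        simp [List.getLastD_eq_getLast?, List.getLast?_eq_some_getLast hb]

theorem RightClampedOutside.append {s : BSeq} {a : ℕ} (h : RightClampedOutside s a) (u : BSeq)
    {v : BSeq} (hv : a ∉ syms v) : RightClampedOutside (u ++ (s ++ v)) a := by
  obtain ⟨u', v', b, rfl, h1, h2, h3⟩ := h
  refine ⟨u ++ u', v' ++ v, b, by simp, by simp [syms_append, h1, hv], h2, h3.trans ?_⟩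
  rw [syms_append u, syms_append _ v]
  exact (List.sublist_append_left _ _).trans (List.sublist_append_right _ _)

theorem rightClampedOutside_copyIns {m : ℕ} (hm : m ≠ 0) (i : ℕ) {A : BSeq} (hA : Good m A)
    {ins : List ℕ} (hlen : (blocks A).length = ins.length) {x : ℕ} (hx : x ∈ syms A) :
    RightClampedOutside (copyIns i A ins ++ [.inl (glob (ins.getLastD 0))]) (loc i x) := by
  rcases hA.clamped x hx with h | h
  · obtain ⟨⟨u, hu⟩, hs⟩ := copyIns_last hm i hA hlen h
    refine ⟨u, [], glob (ins.getLastD 0), by simp [hu], by simp [syms],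
      (loc_ne_glob _ _ _).symm, ?_⟩
    rw [syms_append]
    exact hs.append (List.Sublist.refl [glob (ins.getLastD 0)])
  · have hA1 : ∀ b ∈ blocks A, b ≠ [] := by
      rintro _ h rfl; exact hm (hA.wellFormed.length_of_mem_blocks _ h).symm
    obtain ⟨u, v, b, hS, h1, h2, h3⟩ := h
    have hv : ∀ b ∈ blocks v, b ≠ [] := fun b hb => hA1 b (by simp [hS, blocks_append, blocks, hb])
    have : RightClampedOutside (copyIns i A ins) (loc i x) := by
      refine ⟨copyIns i u ins, copyIns i v (ins.drop (blocks u).length), loc i b, ?_, ?_, ?_, ?_⟩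
      · rw [hS, copyIns_append]; rfl
      · intro h
        rcases mem_syms_copyIns hv h with ⟨y, hy, h⟩ | ⟨g, -, h⟩
        · rw [(loc_inj.1 h).2] at h1; exact h1 hy
        · exact loc_ne_glob _ _ _ h
      · simpa [loc_inj] using h2
      · exact (h3.map (loc i)).trans (map_loc_sublist_copyIns i A ins)
    exact this.append [] (by simp [syms, loc_ne_glob])

theorem rightClampedOutside_shuffle_loc {m : ℕ} (hm : m ≠ 0) {A : BSeq} (hA : Good m A)
    {i : ℕ} {B : BSeq} (hB : ∀ b ∈ blocks B, b.length = (blocks A).length) {j x : ℕ}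
    (hx : loc j x ∈ syms (shuffle A i B)) : RightClampedOutside (shuffle A i B) (loc j x) := by
  have hA1 : ∀ b ∈ blocks A, b ≠ [] := by
    rintro _ h rfl; exact hm (hA.wellFormed.length_of_mem_blocks _ h).symm
  induction B generalizing i with
  | nil => simp [shuffle, syms] at hx
  | cons y B ih =>
    cases y with
    | inl a =>
      have hx : loc j x ∈ syms (shuffle A i B) := by
        simpa [shuffle, syms, loc_ne_glob] using hx
      simpa [shuffle] using (ih hB hx).append [.inl (glob a)] (v := []) (by simp [syms])
    | inr b =>
      have hB' : ∀ c ∈ blocks B, c.length = (blocks A).length :=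
        fun c hc => hB c (List.mem_cons_of_mem _ hc)
      by_cases h : loc j x ∈ syms (shuffle A (i + 1) B)
      · have := (ih hB' h).append
          (copyIns i A b ++ [.inl (glob (b.getLastD 0))]) (v := []) (by simp [syms])
        rwa [List.append_nil, List.append_assoc] at this
      · have hx : loc j x ∈ syms (copyIns i A b) := by
          simpa [shuffle, syms, syms_append, loc_ne_glob, h] using hx
        rcases mem_syms_copyIns hA1 hx with ⟨y, hy, he⟩ | ⟨g, -, he⟩
        · obtain ⟨rfl, rfl⟩ := loc_inj.1 he
          simpa [shuffle] using (rightClampedOutside_copyIns hm j hA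
            (hB b (by simp [blocks])).symm hy).append [] h
        · exact absurd he (loc_ne_glob _ _ _)

theorem Good.shuffle {m : ℕ} (hm : m ≠ 0) {A B : BSeq} (hA : Good m A)
    (hB : Good (blocks A).length B) : Good (m + 1) (BSeq.shuffle A 0 B) := by
  have hBl := hB.wellFormed.length_of_mem_blocks
  have hA1 : ∀ b ∈ blocks A, b ≠ [] := by
    rintro _ h rfl; exact hm (hA.wellFormed.length_of_mem_blocks _ h).symm
  have hB1 : ∀ b ∈ blocks B, b ≠ [] := by
    rintro _ h rfl; exact hA.blocks_ne (List.length_eq_zero_iff.1 (hBl _ h).symm)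
  refine ⟨blocks_shuffle_ne hA.blocks_ne 0 hB.blocks_ne,
    hA.wellFormed.shuffle hm hA.blocks_ne hB.wellFormed (by simp) (by simp),
    recurs_shuffle hm hA 0 hBl, fun a ha => ?_⟩
  rcases mem_syms_shuffle hA1 hB1 ha with ⟨j, -, x, -, rfl⟩ | ⟨g, hg, rfl⟩
  · exact .inr (rightClampedOutside_shuffle_loc hm hA hBl ha)
  · rcases hB.clamped g hg with h | ⟨u, v, b, hS, h1, h2, h3⟩
    · left; rw [getLast?_syms_shuffle A 0 B hB1, h]; rfl
    · refine .inr ⟨BSeq.shuffle A 0 u, BSeq.shuffle A (0 + (blocks u).length) v, glob b,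
        ?_, ?_, ?_, ?_⟩
      · rw [hS, shuffle_append]; rfl
      · intro h
        have hv : ∀ b ∈ blocks v, b ≠ [] :=
          fun b hb => hB1 b (by simp [hS, blocks_append, blocks, hb])
        rcases mem_syms_shuffle hA1 hv h with ⟨j, -, x, -, h⟩ | ⟨g', hg', h⟩
        · exact loc_ne_glob _ _ _ h.symm
        · rw [glob_inj.1 h] at h1; exact h1 hg'
      · simpa [glob_inj] using h2
      · exact (h3.map glob).trans (map_glob_sublist_shuffle A 0 B hBl)

/-! ### Splitting blocks -/

theorem split_append (s t : BSeq) : split (s ++ t) = split s ++ split t := by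
  induction s with
  | nil => rfl
  | cons x s ih => cases x <;> simp [split, ih]

theorem syms_split (S : BSeq) : syms (split S) = syms S := by
  have hb (b : List ℕ) : syms (b.map fun x => .inr [x]) = b := by
    induction b with
    | nil => rfl
    | cons x b ih => simp [syms, ih]
  induction S with
  | nil => rfl
  | cons x S ih => cases x <;> simp [split, syms, syms_append, hb, ih]

theorem WellFormed.split {m : ℕ} {T : Set ℕ} {S : BSeq} (h : WellFormed m T S) :
    WellFormed 1 T (BSeq.split S) := by
  have hb : ∀ (b : List ℕ) (T : Set ℕ) (r : BSeq), b.Nodup → (∀ x ∈ b, x ∉ T) →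
      WellFormed 1 (T ∪ {x | x ∈ b}) r →
      WellFormed 1 T (b.map (fun x => .inr [x]) ++ r) := by
    intro b
    induction b with
    | nil => intro T r _ _ h; simpa using h
    | cons x b ih =>
      intro T r hn hT h
      rw [List.nodup_cons] at hn
      refine ⟨rfl, by simp, by simpa using hT x (by simp), ih _ _ hn.2 ?_ ?_⟩
      · rintro y hy (h | h)
        · exact hT y (by simp [hy]) h
        · have : y = x := by simpa using h
          exact hn.1 (this ▸ hy)
      · convert h using 1
        ext y
        simp [or_assoc, or_left_comm]
  induction S generalizing T with
  | nil => trivial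
  | cons x S ih =>
    cases x with
    | inl a => exact ⟨h.1, ih h.2⟩
    | inr b => exact hb b T _ h.2.1 h.2.2.1 (ih h.2.2.2)

theorem Good.split {S : BSeq} (h : Good 2 S) : Good 1 (BSeq.split S) := by
  have hw := h.wellFormed.split
  refine ⟨?_, hw, ?_, fun a ha => ?_⟩
  · obtain ⟨u, b, t, rfl⟩ := exists_last_block h.blocks_ne
    have hb : b.length = 2 := h.wellFormed.length_of_mem_blocks b (by simp [blocks_append, blocks])
    obtain ⟨p, q, rfl⟩ := List.length_eq_two.1 hb
    simp [split_append, BSeq.split, blocks_append, blocks]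
  · have : ∀ (T : Set ℕ) (S : BSeq), WellFormed 1 T S → ForallBlock Recurs S := by
      intro T S h
      induction S generalizing T with
      | nil => trivial
      | cons x S ih =>
        cases x with
        | inl a => exact ih _ h.2
        | inr b =>
          obtain ⟨x, rfl⟩ := List.length_eq_one_iff.1 h.1
          exact ⟨by simp [Recurs], ih _ h.2.2.2⟩
    exact this _ _ hw
  · rw [syms_split] at ha ⊢
    refine (h.clamped a ha).imp_right ?_
    rintro ⟨u, v, b, hS, h1, h2, h3⟩
    refine ⟨BSeq.split u, BSeq.split v, b, ?_, by rwa [syms_split], h2, by rwa [syms_split]⟩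
    rw [hS, split_append]; rfl

/-! ### The Hart–Sharir sequences -/

/-- The structured form of `S₁(n + 1)`. -/
def first (n : ℕ) : BSeq :=
  .inr (List.range' 1 (n + 1)) ::
    ((List.range' 1 n).reverse ++ List.range' 2 n).map .inl

theorem toks_map_inl (t : List ℕ) : toks (t.map .inl) = t.map Tok.sym := by
  induction t with
  | nil => rfl
  | cons a t ih => simp [toks, ih]

theorem S1_eq (n : ℕ) : S1 (n + 1) = toks (first n) := by
  simp only [S1, first, toks, toks_map_inl, Nat.add_sub_cancel]
  simp

theorem good_first (n : ℕ) : Good (n + 1) (first n) := by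
  have hwf : ∀ (t : List ℕ) (T : Set ℕ), (∀ x ∈ t, x ∈ T) →
      WellFormed (n + 1) T (t.map .inl) := by
    intro t T h
    induction t with
    | nil => trivial
    | cons x t ih => exact ⟨h x (by simp), ih fun y hy => h y (by simp [hy])⟩
  have hfb : ∀ t : List ℕ, ForallBlock Recurs (t.map .inl) := by
    intro t
    induction t with
    | nil => trivial
    | cons x t ih => exact ih
  refine ⟨by simp [first, blocks], ⟨by simp, List.nodup_range', by simp, hwf _ _ ?_⟩,
    ⟨?_, hfb _⟩, fun a ha => ?_⟩
  · intro x hx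
    simp only [List.mem_append, List.mem_reverse, List.mem_range'_1] at hx
    simp only [Set.mem_union, Set.mem_ofPred_eq, List.mem_range'_1]
    omega
  · intro x hx
    rw [List.range'_concat, List.dropLast_concat] at hx
    rw [syms_map_inl]
    simp [hx]
  · have ha' : 1 ≤ a ∧ a ≤ n + 1 := by
      simp only [first, syms, syms_map_inl, List.mem_append, List.mem_reverse,
        List.mem_range'_1] at ha
      omega
    rcases Nat.lt_or_ge n a with h | h
    · left
      obtain rfl : a = n + 1 := by omega
      cases n with
      | zero => simp [first, syms]
      | succ n =>
        simp only [first, syms, syms_map_inl, List.range'_concat]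
        simp [List.getLast?_append, List.getLast?_cons]
        omega
    · right
      obtain ⟨k, rfl⟩ : ∃ k, n = k + 1 := ⟨n - 1, by omega⟩
      have htail : (List.range' 1 (k + 1)).reverse ++ List.range' 2 (k + 1) =
          (List.range' 2 k).reverse ++ List.range' 1 (k + 2) := by
        rw [List.range'_succ (s := 1) (n := k), List.range'_succ (s := 1) (n := k + 1)]
        simp
      have hsplit : List.range' 1 (k + 2) =
          List.range' 1 (a - 1) ++ a :: (a + 1) :: List.range' (a + 2) (k + 1 - a) := by
        have h1 : k + 2 = (a - 1) + (k + 1 - a + 1 + 1) := by omega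
        rw [h1, ← List.range'_append_1, List.range'_succ, List.range'_succ]
        have h2 : 1 + (a - 1) = a := by omega
        simp [h2]
      have hsub : [a, a + 1].Sublist (List.range' 1 (k + 2)) := by
        rw [hsplit]
        exact (((List.nil_sublist _).cons_cons _).cons_cons _).trans
          (List.sublist_append_right _ _)
      refine ⟨.inr (List.range' 1 (k + 2)) ::
          ((List.range' 2 k).reverse ++ List.range' 1 (a - 1)).map .inl,
        (List.range' (a + 2) (k + 1 - a)).map .inl, a + 1, ?_, ?_, by omega, ?_⟩
      · rw [first, htail]
        conv_lhs => rw [List.map_append]; rhs; rhs; rw [hsplit]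
        simp
      · rw [syms_map_inl]; simp
      · simp only [first, syms, syms_map_inl, htail]
        exact hsub.append (hsub.trans (List.sublist_append_right _ _))

theorem HS_eq_shuffle {k m : ℕ} {A B : BSeq} (hA : HS (k + 2) (m + 1) = toks A)
    (hAg : Good (m + 1) A) (hB : HS (k + 1) (blocks A).length = toks B)
    (hBg : Good (blocks A).length B) : HS (k + 2) (m + 2) = toks (shuffle A 0 B) := by
  rw [HS, hA, numBlocks_toks, hB, bullet, bulletAux_toks]
  · rintro _ h rfl
    exact absurd (hAg.wellFormed.length_of_mem_blocks _ h) (by simp)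
  · rintro _ h rfl
    exact hAg.blocks_ne (List.length_eq_zero_iff.1 (hBg.wellFormed.length_of_mem_blocks _ h).symm)

theorem exists_good (k m : ℕ) (hm : m ≠ 0) : ∃ S : BSeq, HS (k + 1) m = toks S ∧ Good m S := by
  obtain ⟨m, rfl⟩ := Nat.exists_eq_succ_of_ne_zero hm
  clear hm
  induction k generalizing m with
  | zero => exact ⟨first m, by rw [HS, S1_eq], good_first m⟩
  | succ k ihk =>
    induction m with
    | zero =>
      obtain ⟨S, hS, hg⟩ := ihk 1
      exact ⟨split S, by rw [HS, hS, split2_toks S hg.wellFormed.length_of_mem_blocks], hg.split⟩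
    | succ m ihm =>
      obtain ⟨A, hA, hAg⟩ := ihm
      obtain ⟨n, hn⟩ := Nat.exists_eq_succ_of_ne_zero
        (mt List.length_eq_zero_iff.1 hAg.blocks_ne)
      obtain ⟨B, hB, hBg⟩ := ihk n
      rw [← hn] at hB hBg
      exact ⟨_, HS_eq_shuffle hA hAg hB hBg, hAg.shuffle m.succ_ne_zero hBg⟩

theorem exists_split_of_mem_blocks {P : List ℕ → BSeq → Prop} {m : ℕ} {S : BSeq} {T : Set ℕ}
    (hS : WellFormed m T S) (hP : ForallBlock P S) {b : List ℕ} (hb : b ∈ blocks S) :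
    ∃ u v, S = u ++ .inr b :: v ∧ P b v ∧ b.Nodup ∧ ∀ x ∈ b, x ∉ syms u ∧ x ∉ T := by
  induction S generalizing T with
  | nil => simp [blocks] at hb
  | cons y S ih =>
    cases y with
    | inl a =>
      obtain ⟨u, v, rfl, h1, h2, h3⟩ := ih hS.2 hP hb
      refine ⟨.inl a :: u, v, rfl, h1, h2, fun x hx => ⟨?_, (h3 x hx).2⟩⟩
      have : x ≠ a := by rintro rfl; exact (h3 x hx).2 hS.1
      simp [syms, this, (h3 x hx).1]
    | inr c =>
      by_cases hbc : b = c
      · subst hbc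
        exact ⟨[], S, rfl, hP.1, hS.2.1, fun x hx => ⟨by simp [syms], hS.2.2.1 x hx⟩⟩
      · obtain ⟨u, v, rfl, h1, h2, h3⟩ := ih hS.2.2.2 hP.2
          ((List.mem_cons.1 hb).resolve_left hbc)
        refine ⟨.inr c :: u, v, rfl, h1, h2, fun x hx => ?_⟩
        obtain ⟨h4, h5⟩ := h3 x hx
        simp only [Set.mem_union, Set.mem_ofPred_eq, not_or] at h5
        exact ⟨by simp [syms, h4, h5.2], h5.1⟩

theorem leftClamped_of_rankOf {m : ℕ} (hm : m ≠ 0) {S : BSeq} (hS : WellFormed m ∅ S)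
    (hc : ForallBlock ClampsLast S) {a : ℕ} (ha : rankOf (toks S) a = m) :
    LeftClamped (syms S) a := by
  unfold rankOf at ha
  rw [blocksOf_toks] at ha
  split at ha
  · rename_i b hfind
    have hb := List.mem_of_find?_eq_some hfind
    have hab : a ∈ b := by simpa using List.find?_some hfind
    have hlen := hS.length_of_mem_blocks b hb
    obtain ⟨u, v, rfl, ⟨c, q, g, v', rfl, rfl, hg⟩, hnd, hu⟩ :=
      exists_split_of_mem_blocks hS hc hb
    obtain rfl : a = g := by
      have hi : (c ++ [q, g])[(c ++ [q, g]).idxOf a]? = some a := by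
        rw [List.getElem?_eq_getElem (List.idxOf_lt_length_iff.2 hab), List.getElem_idxOf]
      have h2 : (c ++ [q, g]).idxOf a = c.length + 1 := by
        simp only [List.length_append, List.length_cons, List.length_nil] at hlen
        omega
      rw [h2, List.getElem?_append_right (by omega)] at hi
      simpa using hi.symm
    have hnd' : a ∉ c ∧ q ≠ a := by
      rw [List.nodup_append] at hnd
      refine ⟨fun h => hnd.2.2 a h a (by simp) rfl, ?_⟩
      simpa using hnd.2.1
    refine ⟨syms u ++ c, q :: syms v', q, by simp [syms_append, syms], ?_, hnd'.2, ?_⟩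
    · simp [hnd'.1, (hu a (by simp)).1]
    · have h : syms (u ++ .inr (c ++ [q, a]) :: .inl q :: v') =
          (syms u ++ c) ++ q :: a :: q :: syms v' := by simp [syms_append, syms]
      rw [h]
      exact ((((List.singleton_sublist.2 hg).cons_cons _).cons_cons _).cons_cons _).trans
        (List.sublist_append_right _ _)
  · exact absurd ha.symm hm

theorem RightClampedOutside.rightClamped {S : BSeq} {a : ℕ} (h : RightClampedOutside S a) :
    RightClamped (syms S) a := by
  obtain ⟨u, v, b, hS, h1, h2, h3⟩ := h
  exact ⟨syms u, syms v, b, by rw [hS, syms_append]; rfl, h1, h2, h3⟩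

end BSeq

/-- Corollary `cor_global_clamped`: let `k ≥ 1` and `m′ ≥ 2`, and write
`S_{k+1}(m′) = S_{k+1}(m′−1) • S_k(N)`.  Every global symbol of `S_{k+1}(m′)`
(equivalently, every symbol of rank `m′`) is left-clamped in `S_{k+1}(m′)`, and
every global symbol except the very last symbol of `S_{k+1}(m′)` is right-clamped
in `S_{k+1}(m′)`. -/
theorem cor_global_clamped (k m' : ℕ) (hk : 1 ≤ k) (hm' : 2 ≤ m') :
    ∀ a ∈ symsOf (HS (k + 1) m'), rankOf (HS (k + 1) m') a = m' →
      LeftClamped (symsOf (HS (k + 1) m')) a ∧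
      ((symsOf (HS (k + 1) m')).getLast? ≠ some a →
        RightClamped (symsOf (HS (k + 1) m')) a) := by
  obtain ⟨k, rfl⟩ : ∃ j, k = j + 1 := ⟨k - 1, by omega⟩
  obtain ⟨m, rfl⟩ : ∃ n, m' = n + 2 := ⟨m' - 2, by omega⟩
  obtain ⟨A, hA, hAg⟩ := BSeq.exists_good (k + 1) (m + 1) m.succ_ne_zero
  obtain ⟨B, hB, hBg⟩ := BSeq.exists_good k (BSeq.blocks A).length
    (mt List.length_eq_zero_iff.1 hAg.blocks_ne)
  have hS := hAg.shuffle m.succ_ne_zero hBg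
  rw [BSeq.HS_eq_shuffle hA hAg hB hBg, BSeq.symsOf_toks]
  intro a ha hrank
  exact ⟨BSeq.leftClamped_of_rankOf (m + 1).succ_ne_zero hS.wellFormed
      (BSeq.clampsLast_shuffle m.succ_ne_zero hAg 0 hBg.wellFormed.length_of_mem_blocks
        hBg.recurs) hrank,
    fun hlast => ((hS.clamped a ha).resolve_left hlast).rightClamped⟩
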